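/- arXiv:1910.13659 — 6 statements merged into one kernel-verified Lean document; each statement's English description precedes it below -/
import Mathlib

section
/- Let a_1, ..., a_n be vectors in ℝ^d satisfying ∑_{i=1}^n a_i = 0, and let B be a subset of {1, ..., n} of cardinality m (with 1 ≤ m ≤ n) chosen uniformly at random among all subsets of cardinality m. Then E‖(1/m) ∑_{i∈B} a_i‖₂² ≤ (𝟙{m < n}/(m·n)) · ∑_{i=1}^n ‖a_i‖₂², where the expectation is over the random choice of B and 𝟙{m < n} equals 1 if m < n and 0 if m = n. -/
open Finset

/-- The sum over all `m`-subsets of the squared norms of the subset sums, expanded through the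
number of `m`-subsets containing each pair of indices. -/
theorem sum_powersetCard_norm_sum_sq {ι E : Type*} [Fintype ι] [DecidableEq ι]
    [NormedAddCommGroup E] [InnerProductSpace ℝ E] (m : ℕ) (a : ι → E) :
    ∑ B ∈ powersetCard m (univ : Finset ι), ‖∑ i ∈ B, a i‖ ^ 2 =
      ∑ i, ∑ j, (#{B ∈ powersetCard m (univ : Finset ι) | {i, j} ⊆ B} : ℝ) *
        inner ℝ (a i) (a j) := by
  have expand (B : Finset ι) : ‖∑ i ∈ B, a i‖ ^ 2 =
      ∑ i, ∑ j, if {i, j} ⊆ B then inner ℝ (a i) (a j) else 0 := by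
    rw [← real_inner_self_eq_norm_sq, sum_inner]
    simp only [inner_sum, insert_subset_iff, singleton_subset_iff, ite_and]
    simp
  simp only [expand]
  rw [sum_comm]
  refine sum_congr rfl fun i _ => ?_
  rw [sum_comm]
  refine sum_congr rfl fun j _ => ?_
  rw [← sum_filter, sum_const, nsmul_eq_mul]

/-- For vectors summing to zero, distinct indices contribute nonpositively, so only the diagonal
terms matter for an upper bound. -/
theorem sum_powersetCard_norm_sum_sq_le {ι E : Type*} [Fintype ι]
    [NormedAddCommGroup E] [InnerProductSpace ℝ E] {m : ℕ} (hm : 1 ≤ m)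
    (a : ι → E) (hsum : ∑ i, a i = 0) :
    ∑ B ∈ powersetCard m (univ : Finset ι), ‖∑ i ∈ B, a i‖ ^ 2 ≤
      ((Fintype.card ι - 1).choose (m - 1) : ℝ) * ∑ i, ‖a i‖ ^ 2 := by
  classical
  rw [sum_powersetCard_norm_sum_sq]
  obtain ⟨q, hq0, hq⟩ : ∃ q : ℝ, 0 ≤ q ∧ ∀ i j, i ≠ j →
      (#{B ∈ powersetCard m (univ : Finset ι) | {i, j} ⊆ B} : ℝ) = q := by
    by_cases h2 : 2 ≤ m
    · refine ⟨((Fintype.card ι - 2).choose (m - 2) : ℝ), by positivity, fun i j hij => ?_⟩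
      rw [card_filter_powersetCard_subset _ _ _ (subset_univ _) (by rwa [card_pair hij]),
        card_pair hij, card_univ]
    · refine ⟨0, le_rfl, fun i j hij => ?_⟩
      rw [Nat.cast_eq_zero, card_eq_zero, filter_eq_empty_iff]
      intro B hB hs
      have := card_le_card hs
      rw [card_pair hij, mem_powersetCard_univ.1 hB] at this
      omega
  have row (i : ι) : ∑ j, (#{B ∈ powersetCard m (univ : Finset ι) | {i, j} ⊆ B} : ℝ) *
      inner ℝ (a i) (a j) ≤ ((Fintype.card ι - 1).choose (m - 1) : ℝ) * ‖a i‖ ^ 2 := by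
    have hoff : ∑ j ∈ univ.erase i, inner ℝ (a i) (a j) = -‖a i‖ ^ 2 := by
      rw [sum_erase_eq_sub (mem_univ i), ← inner_sum, hsum, inner_zero_right,
        real_inner_self_eq_norm_sq, zero_sub]
    rw [← add_sum_erase _ _ (mem_univ i),
      sum_congr rfl fun j hj => by rw [hq i j (ne_of_mem_erase hj).symm], ← mul_sum, hoff,
      pair_eq_singleton, card_filter_powersetCard_subset _ _ _ (subset_univ _) (by simpa),
      card_singleton, card_univ, real_inner_self_eq_norm_sq]
    nlinarith [mul_nonneg hq0 (sq_nonneg ‖a i‖)]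
  rw [mul_sum]
  exact sum_le_sum fun i _ => row i

/-- For vectors `a 1, ..., a n` in `ℝ^d` with `∑ i, a i = 0` and a uniformly
random subset `B ⊆ {1,...,n}` of cardinality `m` (`1 ≤ m ≤ n`), the expected squared norm
of the subsample mean satisfies
`E ‖(1/m) ∑_{i ∈ B} a i‖² ≤ 𝟙{m < n}/(m n) · ∑ i ‖a i‖²`. -/
theorem statement0 (d n m : ℕ) (hm : 1 ≤ m) (hmn : m ≤ n)
    (a : Fin n → EuclideanSpace ℝ (Fin d))
    (hsum : ∑ i, a i = 0) :
    (∑ B ∈ Finset.powersetCard m (Finset.univ : Finset (Fin n)),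
        ‖(1 / (m : ℝ)) • ∑ i ∈ B, a i‖ ^ 2) /
      ((Finset.powersetCard m (Finset.univ : Finset (Fin n))).card : ℝ)
    ≤ (if m < n then (1 : ℝ) else 0) / ((m : ℝ) * n) * ∑ i, ‖a i‖ ^ 2 := by
  rcases hmn.lt_or_eq with h | rfl
  · obtain ⟨k, rfl⟩ := Nat.exists_eq_add_of_le' hm
    obtain ⟨l, rfl⟩ := Nat.exists_eq_add_of_le' (hm.trans hmn)
    have key := sum_powersetCard_norm_sum_sq_le hm a hsum
    have hchoose : ((l + 1 : ℕ) : ℝ) * (l.choose k : ℝ) =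
        ((l + 1).choose (k + 1) : ℝ) * ((k + 1 : ℕ) : ℝ) := by
      exact_mod_cast Nat.add_one_mul_choose_eq l k
    have hpos : (0 : ℝ) < ((l + 1).choose (k + 1) : ℝ) := by
      exact_mod_cast Nat.choose_pos hmn
    simp only [Fintype.card_fin, Nat.add_sub_cancel] at key
    simp only [norm_smul, mul_pow, ← mul_sum, if_pos h, card_powersetCard, card_univ,
      Fintype.card_fin, norm_div, norm_one, Real.norm_natCast]
    rw [div_le_iff₀ hpos]
    have hk : (0 : ℝ) < ((k + 1 : ℕ) : ℝ) := by positivity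
    have hl : (0 : ℝ) < ((l + 1 : ℕ) : ℝ) := by positivity
    calc _ ≤ (1 / ((k + 1 : ℕ) : ℝ)) ^ 2 * ((l.choose k : ℝ) * ∑ i, ‖a i‖ ^ 2) := by gcongr
      _ = _ := by
        have : (l.choose k : ℝ) =
            ((l + 1).choose (k + 1) : ℝ) * ((k + 1 : ℕ) : ℝ) / ((l + 1 : ℕ) : ℝ) := by
          rw [eq_div_iff hl.ne', ← hchoose, mul_comm]
        rw [this]
        field_simp
  · have huniv : powersetCard m (univ : Finset (Fin m)) = {univ} := by
      simpa using powersetCard_self (univ : Finset (Fin m))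
    simp [huniv, hsum]
end

section
/- Let F : ℝ^d → ℝ be a differentiable function with L-Lipschitz gradient, L > 0, let ζ > 0, let θ ∈ ℝ^d, and let v ∈ ℝ^d with v ≠ 0. Set η = min{ζ/(L‖v‖₂), 1/(2L)} and θ' = θ − η·v. Then F(θ') ≤ F(θ) + (1/(4L))‖∇F(θ) − v‖₂² − (ζ/(4L))‖v‖₂ + ζ²/(2L). -/
/-- Descent lemma: the quadratic upper bound for a differentiable function whose gradient is
`L`-Lipschitz. -/
theorem le_add_inner_gradient_add_sq {E : Type*} [NormedAddCommGroup E] [InnerProductSpace ℝ E]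
    [CompleteSpace E] {F : E → ℝ} {L : ℝ} (hF : Differentiable ℝ F)
    (hlip : ∀ x y : E, ‖gradient F x - gradient F y‖ ≤ L * ‖x - y‖) (x h : E) :
    F (x + h) ≤ F x + inner ℝ (gradient F x) h + L / 2 * ‖h‖ ^ 2 := by
  have hline (t : ℝ) : HasDerivAt (fun t : ℝ => x + t • h) h t := by
    simpa using ((hasDerivAt_id t).smul_const h).const_add x
  have hf (t : ℝ) : HasDerivAt (fun t : ℝ => F (x + t • h))
      (inner ℝ (gradient F (x + t • h)) h) t := by
    have hcomp := (hF (x + t • h)).hasGradientAt.hasFDerivAt.comp_hasDerivAt t (hline t)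
    rwa [InnerProductSpace.toDual_apply_apply] at hcomp
  have hB (t : ℝ) : HasDerivAt
      (fun t : ℝ => F x + t * inner ℝ (gradient F x) h + L / 2 * ‖h‖ ^ 2 * t ^ 2)
      (inner ℝ (gradient F x) h + L * ‖h‖ ^ 2 * t) t := by
    refine ((((hasDerivAt_id t).mul_const (inner ℝ (gradient F x) h)).const_add (F x)).add
      ((hasDerivAt_pow 2 t).const_mul (L / 2 * ‖h‖ ^ 2))).congr_deriv ?_
    push_cast
    ring
  have key := image_le_of_deriv_right_le_deriv_boundary (a := 0) (b := 1)
    (fun t _ => (hf t).continuousAt.continuousWithinAt) (fun t _ => (hf t).hasDerivWithinAt)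
    (by simp) (fun t _ => (hB t).continuousAt.continuousWithinAt)
    (fun t _ => (hB t).hasDerivWithinAt)
    (fun t ht => by
      have hinner := real_inner_le_norm (gradient F (x + t • h) - gradient F x) h
      have hgrad := mul_le_mul_of_nonneg_right (hlip (x + t • h) x) (norm_nonneg h)
      rw [add_sub_cancel_left, norm_smul, Real.norm_of_nonneg ht.1] at hgrad
      rw [inner_sub_left] at hinner
      linarith)
    (Set.right_mem_Icc.2 zero_le_one)
  simpa using key

/-- Key per-iteration inequality of DP-SRGD: for `F` differentiable with
`L`-Lipschitz gradient (`L > 0`), `ζ > 0`, `v ≠ 0`, `η = min{ζ/(L‖v‖), 1/(2L)}` and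
`θ' = θ − η v`, one has
`F(θ') ≤ F(θ) + (1/(4L))‖∇F(θ) − v‖² − (ζ/(4L))‖v‖ + ζ²/(2L)`. -/
theorem statement7 (d : ℕ) (L ζ : ℝ) (hL : 0 < L) (hζ : 0 < ζ)
    (F : EuclideanSpace ℝ (Fin d) → ℝ)
    (hF : Differentiable ℝ F)
    (hlip : ∀ x y : EuclideanSpace ℝ (Fin d), ‖gradient F x - gradient F y‖ ≤ L * ‖x - y‖)
    (θ v : EuclideanSpace ℝ (Fin d)) (hv : v ≠ 0)
    (η : ℝ) (hη : η = min (ζ / (L * ‖v‖)) (1 / (2 * L)))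
    (θ' : EuclideanSpace ℝ (Fin d)) (hθ' : θ' = θ - η • v) :
    F θ' ≤ F θ + (1 / (4 * L)) * ‖gradient F θ - v‖ ^ 2
      - (ζ / (4 * L)) * ‖v‖ + ζ ^ 2 / (2 * L) := by
  have hn : 0 < ‖v‖ := norm_pos_iff.2 hv
  have hη0 : 0 ≤ η := by rw [hη]; positivity
  have hηL : η ≤ 1 / (2 * L) := hη ▸ min_le_right _ _
  have hLη : L * η ≤ 1 / 2 := by
    calc L * η ≤ L * (1 / (2 * L)) := by gcongr
      _ = 1 / 2 := by field_simp
  have hdescent := le_add_inner_gradient_add_sq hF hlip θ (-(η • v))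
  rw [← sub_eq_add_neg, ← hθ', inner_neg_right, inner_smul_right, norm_neg, norm_smul,
    Real.norm_of_nonneg hη0] at hdescent
  have hpolar := norm_sub_sq_real (gradient F θ) v
  have hgrad : η / 2 * ‖gradient F θ - v‖ ^ 2 ≤ 1 / (4 * L) * ‖gradient F θ - v‖ ^ 2 := by
    refine mul_le_mul_of_nonneg_right ?_ (sq_nonneg _)
    calc η / 2 ≤ 1 / (2 * L) / 2 := by linarith
      _ = 1 / (4 * L) := by field_simp; norm_num
  have hquad : L / 2 * (η * ‖v‖) ^ 2 ≤ η / 4 * ‖v‖ ^ 2 := by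
    have := mul_le_mul_of_nonneg_right hLη (by positivity : 0 ≤ η / 2 * ‖v‖ ^ 2)
    linarith
  have hcross : -(η * inner ℝ (gradient F θ) v)
      ≤ η / 2 * ‖gradient F θ - v‖ ^ 2 - η / 2 * ‖v‖ ^ 2 := by
    rw [hpolar]
    have : 0 ≤ η / 2 * ‖gradient F θ‖ ^ 2 := by positivity
    linarith
  have hstep : ζ / (4 * L) * ‖v‖ - ζ ^ 2 / (2 * L) ≤ η / 4 * ‖v‖ ^ 2 := by
    rcases min_choice (ζ / (L * ‖v‖)) (1 / (2 * L)) with hmin | hmin <;> rw [hη, hmin]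
    · have : ζ / (L * ‖v‖) / 4 * ‖v‖ ^ 2 = ζ / (4 * L) * ‖v‖ := by field_simp
      have : 0 ≤ ζ ^ 2 / (2 * L) := by positivity
      linarith
    · have hsq : 0 ≤ ((‖v‖ - ζ) ^ 2 + 3 * ζ ^ 2) / (8 * L) := by positivity
      have : ((‖v‖ - ζ) ^ 2 + 3 * ζ ^ 2) / (8 * L) =
          1 / (2 * L) / 4 * ‖v‖ ^ 2 - (ζ / (4 * L) * ‖v‖ - ζ ^ 2 / (2 * L)) := by
        field_simp
        ring
      linarith
  linarith
end

section
/- Let α ≥ 3 be a natural number and let τ > 0 and σ > 0 be real numbers. If q := τ·α·e^{(α−1)/(2σ²)} < 1, then ∑_{j=3}^{α} τ^j · C(α, j) · 2·e^{(j−1)j/(2σ²)} ≤ 2·τ²·C(α, 2) · (τ·α·e^{3(α−1)/(2σ²)}) / (1 − τ·α·e^{(α−1)/(2σ²)}). -/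
open Finset Real

theorem Nat.choose_add_le_choose_mul_pow (n k i : ℕ) :
    n.choose (k + i) ≤ n.choose k * n ^ i := by
  induction i with
  | zero => simp
  | succ i ih =>
    calc n.choose (k + i + 1) ≤ n.choose (k + i + 1) * (k + i + 1) :=
          Nat.le_mul_of_pos_right _ (Nat.succ_pos _)
      _ = n.choose (k + i) * (n - (k + i)) := Nat.choose_succ_right_eq n (k + i)
      _ ≤ n.choose k * n ^ i * n := Nat.mul_le_mul ih (Nat.sub_le _ _)
      _ = n.choose k * n ^ (i + 1) := by ring

theorem geom_sum_le_inv_one_sub {q : ℝ} (hq₀ : 0 ≤ q) (hq₁ : q < 1) (n : ℕ) :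
    ∑ i ∈ Finset.range n, q ^ i ≤ (1 - q)⁻¹ := by
  rw [← tsum_geometric_of_lt_one hq₀ hq₁]
  exact (summable_geometric_of_lt_one hq₀ hq₁).sum_le_tsum _ fun i _ => pow_nonneg hq₀ i

/-- Geometric-series bound for the higher-order terms in the Rényi divergence
expansion of the subsampled Gaussian mechanism: if `τ·α·e^{(α−1)/(2σ²)} < 1`, then
`∑_{j=3}^{α} τ^j C(α,j) 2 e^{(j−1)j/(2σ²)}
   ≤ 2 τ² C(α,2) · τ α e^{3(α−1)/(2σ²)} / (1 − τ α e^{(α−1)/(2σ²)})`. -/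
theorem statement10 (α : ℕ) (hα : 3 ≤ α) (τ σ : ℝ) (hτ : 0 < τ) (hσ : 0 < σ)
    (hq : τ * α * Real.exp (((α : ℝ) - 1) / (2 * σ ^ 2)) < 1) :
    ∑ j ∈ Finset.Icc 3 α,
        τ ^ j * (α.choose j : ℝ) * (2 * Real.exp (((j : ℝ) - 1) * j / (2 * σ ^ 2)))
      ≤ 2 * τ ^ 2 * (α.choose 2 : ℝ) *
          (τ * α * Real.exp (3 * ((α : ℝ) - 1) / (2 * σ ^ 2))) /
          (1 - τ * α * Real.exp (((α : ℝ) - 1) / (2 * σ ^ 2))) := by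
  set E := Real.exp (((α : ℝ) - 1) / (2 * σ ^ 2)) with hE
  have hE_cube : Real.exp (3 * ((α : ℝ) - 1) / (2 * σ ^ 2)) = E ^ 3 := by
    rw [hE, ← Real.exp_nat_mul]
    congr 1
    push_cast
    ring
  have hterm (i : ℕ) (hi : 3 + i ≤ α) :
      τ ^ (3 + i) * (α.choose (3 + i) : ℝ) *
          (2 * Real.exp ((((3 + i : ℕ) : ℝ) - 1) * (3 + i : ℕ) / (2 * σ ^ 2)))
        ≤ 2 * τ ^ 2 * (α.choose 2 : ℝ) * (τ * α * E ^ 3) * (τ * α * E) ^ i := by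
    have hchoose : (α.choose (3 + i) : ℝ) ≤ α.choose 2 * (α : ℝ) ^ (1 + i) := by
      have h := Nat.choose_add_le_choose_mul_pow α 2 (1 + i)
      rw [← add_assoc] at h
      exact_mod_cast h
    have hexp : Real.exp ((((3 + i : ℕ) : ℝ) - 1) * (3 + i : ℕ) / (2 * σ ^ 2))
        ≤ E ^ (3 + i) := by
      rw [hE, ← Real.exp_nat_mul, mul_comm, ← mul_div_assoc]
      gcongr
    calc _ ≤ τ ^ (3 + i) * (α.choose 2 * (α : ℝ) ^ (1 + i)) * (2 * E ^ (3 + i)) := by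
          gcongr
      _ = _ := by ring
  rw [hE_cube, ← Finset.Ico_add_one_right_eq_Icc, Finset.sum_Ico_eq_sum_range]
  calc _ ≤ ∑ i ∈ Finset.range (α + 1 - 3),
        2 * τ ^ 2 * (α.choose 2 : ℝ) * (τ * α * E ^ 3) * (τ * α * E) ^ i := by
        refine Finset.sum_le_sum fun i hi => hterm i ?_
        have := Finset.mem_range.mp hi
        omega
    _ ≤ _ := by
        rw [← Finset.mul_sum, div_eq_mul_inv]
        gcongr
        exact geom_sum_le_inv_one_sub (by positivity) hq _
end

section
/- Let α ≥ 1 and τ ∈ (0, 1) be real numbers and let σ be a real number with σ² ≥ 3/2. If α ≤ log(1/(τ(1 + σ²))), then α − 1 ≤ σ² · log(1/(τ·α·(1 + σ²))). -/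
/-- For real `α ≥ 1`, `τ ∈ (0,1)`, `σ² ≥ 3/2`: if `α ≤ log(1/(τ(1+σ²)))`
then `α − 1 ≤ σ² log(1/(τ α (1+σ²)))`. -/
theorem statement12 (α τ σ : ℝ) (hα : 1 ≤ α) (hτ0 : 0 < τ) (hτ1 : τ < 1)
    (hσ : 3 / 2 ≤ σ ^ 2)
    (h : α ≤ Real.log (1 / (τ * (1 + σ ^ 2)))) :
    α - 1 ≤ σ ^ 2 * Real.log (1 / (τ * α * (1 + σ ^ 2))) := by
  have hα0 : 0 < α := by linarith
  have hsplit : Real.log (1 / (τ * α * (1 + σ ^ 2)))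
      = Real.log (1 / (τ * (1 + σ ^ 2))) - Real.log α := by
    rw [← Real.log_div (by positivity) hα0.ne']
    congr 1
    field_simp
  have hlog : Real.log α ≤ α / 4 - 1 + 2 * Real.log 2 := by
    have h4 : Real.log 4 = 2 * Real.log 2 := by
      rw [show (4 : ℝ) = 2 ^ 2 by norm_num, Real.log_pow]
      norm_num
    have hle := Real.log_le_sub_one_of_pos (show 0 < α / 4 by positivity)
    rw [Real.log_div hα0.ne' (by norm_num), h4] at hle
    linarith
  have hlog2 := Real.log_two_lt_d9
  rw [hsplit]
  calc α - 1 ≤ 3 / 2 * (α - Real.log α) := by linarith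
    _ ≤ σ ^ 2 * (α - Real.log α) :=
      mul_le_mul_of_nonneg_right hσ (by linarith)
    _ ≤ σ ^ 2 * (Real.log (1 / (τ * (1 + σ ^ 2))) - Real.log α) :=
      mul_le_mul_of_nonneg_left (by linarith) (sq_nonneg σ)
end

section
/- Let α ≥ 3 be a natural number, let τ ∈ (0, 1), and let σ be a real number with σ² ≥ 3/2. If α − 1 ≤ σ² · log(1/(τ·α·(1 + σ²))), then ∑_{j=3}^{α} τ^j · C(α, j) · 2·e^{(j−1)j/(2σ²)} ≤ 2·τ²·C(α, 2)/σ². -/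
/-- If each term of a sequence is at least `c + 1` times the next one from index `m`
up to `n`, then `c` times the sum of the later terms plus the last one is at most the first. -/
theorem mul_sum_Icc_add_le_of_mul_succ_le {f : ℕ → ℝ} {c : ℝ} {m n : ℕ} (hmn : m ≤ n)
    (hf : ∀ j, m ≤ j → j < n → (c + 1) * f (j + 1) ≤ f j) :
    c * ∑ j ∈ Finset.Icc (m + 1) n, f j + f n ≤ f m := by
  induction n, hmn using Nat.le_induction with
  | base => simp
  | succ n hmn ih =>
    have hprev := ih fun j hj hjn => hf j hj (hjn.trans n.lt_succ_self)
    have hlast := hf n hmn n.lt_succ_self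
    rw [Finset.sum_Icc_succ_top (by omega)]
    linarith

/-- For `j ≥ 2`, the coefficients satisfy `3 C(α, j + 1) ≤ α C(α, j)`. -/
theorem three_mul_choose_succ_le (α : ℕ) {j : ℕ} (hj : 2 ≤ j) :
    3 * α.choose (j + 1) ≤ α * α.choose j :=
  calc 3 * α.choose (j + 1) ≤ α.choose (j + 1) * (j + 1) := by
        rw [mul_comm]; exact Nat.mul_le_mul_left _ (by omega)
    _ = α.choose j * (α - j) := Nat.choose_succ_right_eq α j
    _ ≤ α * α.choose j := by
        rw [mul_comm α]; exact Nat.mul_le_mul_left _ (Nat.sub_le α j)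

/-- Consecutive terms of the Rényi divergence expansion decay by a factor `3 (1 + s)`. -/
theorem renyi_term_succ_le {α j : ℕ} {τ s : ℝ} (hτ : 0 < τ) (hs : 0 < s)
    (h : τ * α * (1 + s) * Real.exp (((α : ℝ) - 1) / s) ≤ 1) (hj : 2 ≤ j) (hjα : j < α) :
    3 * (1 + s) * (τ ^ (j + 1) * (α.choose (j + 1) : ℝ) *
        Real.exp ((((j + 1 : ℕ) : ℝ) - 1) * (j + 1 : ℕ) / (2 * s)))
      ≤ τ ^ j * (α.choose j : ℝ) * Real.exp (((j : ℝ) - 1) * j / (2 * s)) := by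
  have hexp : Real.exp ((((j + 1 : ℕ) : ℝ) - 1) * (j + 1 : ℕ) / (2 * s))
      = Real.exp (((j : ℝ) - 1) * j / (2 * s)) * Real.exp (j / s) := by
    rw [← Real.exp_add]
    congr 1
    push_cast
    field_simp
    ring
  have hmono : Real.exp (j / s) ≤ Real.exp (((α : ℝ) - 1) / s) := by
    have : (j : ℝ) + 1 ≤ α := by exact_mod_cast hjα
    gcongr
    linarith
  have hchoose : 3 * (α.choose (j + 1) : ℝ) ≤ α * α.choose j := by
    exact_mod_cast three_mul_choose_succ_le α hj
  set E := Real.exp (((j : ℝ) - 1) * j / (2 * s))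
  rw [hexp]
  calc 3 * (1 + s) * (τ ^ (j + 1) * (α.choose (j + 1) : ℝ) * (E * Real.exp (j / s)))
      = (1 + s) * τ ^ (j + 1) * E * (3 * (α.choose (j + 1) : ℝ)) * Real.exp (j / s) := by ring
    _ ≤ (1 + s) * τ ^ (j + 1) * E * (α * α.choose j) * Real.exp (((α : ℝ) - 1) / s) := by
        gcongr
    _ = τ ^ j * α.choose j * E * (τ * α * (1 + s) * Real.exp (((α : ℝ) - 1) / s)) := by ring
    _ ≤ τ ^ j * α.choose j * E * 1 := by gcongr
    _ = τ ^ j * α.choose j * E := mul_one _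

/-- For a natural number `α ≥ 3`, `τ ∈ (0,1)` and `σ² ≥ 3/2`: if
`α − 1 ≤ σ² log(1/(τ α (1+σ²)))`, then the higher-order terms in the Rényi divergence
expansion of the subsampled Gaussian mechanism are bounded as
`∑_{j=3}^{α} τ^j C(α,j) 2 e^{(j−1)j/(2σ²)} ≤ 2 τ² C(α,2)/σ²`. -/
theorem statement14 (α : ℕ) (hα : 3 ≤ α) (τ σ : ℝ) (hτ0 : 0 < τ) (hτ1 : τ < 1)
    (hσ : 3 / 2 ≤ σ ^ 2)
    (h : (α : ℝ) - 1 ≤ σ ^ 2 * Real.log (1 / (τ * α * (1 + σ ^ 2)))) :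
    ∑ j ∈ Finset.Icc 3 α,
        τ ^ j * (α.choose j : ℝ) * (2 * Real.exp (((j : ℝ) - 1) * j / (2 * σ ^ 2)))
      ≤ 2 * τ ^ 2 * (α.choose 2 : ℝ) / σ ^ 2 := by
  set s := σ ^ 2
  have hs : 0 < s := by linarith
  have hα0 : (0 : ℝ) < α := by exact_mod_cast (by omega : 0 < α)
  have hpos : 0 < τ * α * (1 + s) := by positivity
  have hsmall : τ * α * (1 + s) * Real.exp (((α : ℝ) - 1) / s) ≤ 1 := by
    have hexp : Real.exp (((α : ℝ) - 1) / s) ≤ 1 / (τ * α * (1 + s)) := by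
      rw [← Real.le_log_iff_exp_le (by positivity), div_le_iff₀ hs]
      linarith
    rwa [le_div_iff₀' hpos] at hexp
  let f : ℕ → ℝ := fun j => τ ^ j * (α.choose j : ℝ) * Real.exp (((j : ℝ) - 1) * j / (2 * s))
  have hsum : (3 * s + 2) * ∑ j ∈ Finset.Icc 3 α, f j + f α ≤ f 2 :=
    mul_sum_Icc_add_le_of_mul_succ_le (by omega) fun j hj hjα => by
      convert renyi_term_succ_le hτ0 hs hsmall hj hjα using 2
      ring
  have hlast : 0 ≤ f α := by positivity
  have hfirst : f 2 ≤ τ ^ 2 * α.choose 2 * 3 := by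
    have harg : (((2 : ℕ) : ℝ) - 1) * (2 : ℕ) / (2 * s) ≤ 1 := by
      rw [div_le_one (by positivity)]
      push_cast
      linarith
    have hexp := (Real.exp_le_exp.mpr harg).trans Real.exp_one_lt_three.le
    exact mul_le_mul_of_nonneg_left hexp (by positivity)
  have hnonneg : 0 ≤ ∑ j ∈ Finset.Icc 3 α, f j :=
    Finset.sum_nonneg fun j _ => by positivity
  calc ∑ j ∈ Finset.Icc 3 α,
        τ ^ j * (α.choose j : ℝ) * (2 * Real.exp (((j : ℝ) - 1) * j / (2 * s)))
      = 2 * ∑ j ∈ Finset.Icc 3 α, f j := by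
        rw [Finset.mul_sum]
        exact Finset.sum_congr rfl fun j _ => by ring
    _ ≤ 2 * τ ^ 2 * (α.choose 2 : ℝ) / s := by
        rw [le_div_iff₀ hs]
        linarith
end

section
/- Let α ≥ 2 be a natural number, let τ ∈ (0, 1), and let σ be a real number with σ² ≥ 3/2. If α ≤ log(1/(τ(1 + σ²))), then (1/(α − 1)) · log(1 + τ²·C(α, 2)·min{4(e^{2/(2σ²)} − 1), 2e^{2/(2σ²)}} + ∑_{j=3}^{α} τ^j·C(α, j)·2·e^{(j−1)j/(2σ²)}) ≤ 5·α·τ²/σ². -/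
open Finset

/-- A cubic upper bound for `exp` on `[0, 2/3]`, in factored form. -/
theorem exp_sub_one_le_mul {x : ℝ} (hx0 : 0 ≤ x) (hx : x ≤ 2 / 3) :
    Real.exp x - 1 ≤ 1433 / 1000 * x := by
  have h := Real.exp_bound' (x := x) hx0 (by linarith) (n := 3) (by norm_num)
  norm_num [Finset.sum_range_succ, Nat.factorial] at h
  nlinarith [mul_nonneg hx0 (sub_nonneg.2 hx), mul_nonneg hx0 (mul_nonneg hx0 (sub_nonneg.2 hx))]

theorem exp_two_thirds_le : Real.exp (2 / 3) ≤ 1956 / 1000 := by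
  have := exp_sub_one_le_mul (x := 2 / 3) (by norm_num) le_rfl
  linarith

theorem choose_add_two_le (n k : ℕ) :
    (n + 2).choose (k + 2) ≤ (n + 2).choose 2 * n.choose k := by
  have h := Nat.choose_mul (n := n + 2) (k := k + 2) (s := 2) (by omega)
  simp only [Nat.add_sub_cancel] at h
  rw [← h]
  exact Nat.le_mul_of_pos_right _ (Nat.choose_pos (by omega))

/-- If `τ (1 + s)` is exponentially small, powers of `τ` absorb the Gaussian moments. -/
theorem pow_mul_exp_le {n k : ℕ} (hk1 : 1 ≤ k) (hk : k ≤ n) {τ s : ℝ} (hτ0 : 0 < τ)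
    (hs : 3 / 2 ≤ s) (hτ : τ * (1 + s) ≤ Real.exp (-((n : ℝ) + 2))) :
    τ ^ k * Real.exp (((k : ℝ) + 1) * (k + 2) / (2 * s)) ≤
      Real.exp (2 / 3) / s * Real.exp (-(2 * (n : ℝ) + 3) / 3) ^ k := by
  have hs0 : 0 < s := by linarith
  have hkn : (k : ℝ) ≤ n := by exact_mod_cast hk
  have hpow : τ ^ k * s ≤ Real.exp (-((n : ℝ) + 2)) ^ k := by
    calc τ ^ k * s ≤ τ ^ k * (1 + s) ^ k := by
          gcongr
          calc s ≤ 1 + s := by linarith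
            _ ≤ (1 + s) ^ k := le_self_pow₀ (by linarith) (by omega)
      _ = (τ * (1 + s)) ^ k := (mul_pow _ _ _).symm
      _ ≤ _ := by gcongr
  have hexp : Real.exp (((k : ℝ) + 1) * (k + 2) / (2 * s)) ≤
      Real.exp (((k : ℝ) + 1) * (k + 2) / 3) := by
    gcongr
    linarith
  rw [div_mul_eq_mul_div, le_div_iff₀ hs0]
  calc τ ^ k * Real.exp (((k : ℝ) + 1) * (k + 2) / (2 * s)) * s
      = τ ^ k * s * Real.exp (((k : ℝ) + 1) * (k + 2) / (2 * s)) := by ring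
    _ ≤ Real.exp (-((n : ℝ) + 2)) ^ k * Real.exp (((k : ℝ) + 1) * (k + 2) / 3) := by gcongr
    _ ≤ _ := by
      rw [← Real.exp_nat_mul, ← Real.exp_nat_mul, ← Real.exp_add, ← Real.exp_add]
      apply Real.exp_le_exp.2
      nlinarith [mul_nonneg (Nat.cast_nonneg (α := ℝ) k) (sub_nonneg.2 hkn)]

theorem one_add_exp_pow_le (n : ℕ) :
    (1 + Real.exp (-(2 * (n : ℝ) + 3) / 3)) ^ n ≤ Real.exp (2 / 3) := by
  have hn : (n : ℝ) * Real.exp (-(2 * (n : ℝ) + 3) / 3) ≤ 2 / 3 := by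
    have h1 : Real.exp (-(2 * (n : ℝ) + 3) / 3) =
        (Real.exp (2 * n / 3) * Real.exp 1)⁻¹ := by
      rw [← Real.exp_add, ← Real.exp_neg]
      ring_nf
    have h2 := Real.add_one_le_exp (2 * (n : ℝ) / 3)
    have h3 := Real.exp_one_gt_d9
    rw [h1, ← div_eq_mul_inv, div_le_iff₀ (by positivity)]
    nlinarith [mul_nonneg (sub_nonneg.2 h2) (sub_nonneg.2 h3.le), Nat.cast_nonneg (α := ℝ) n]
  calc (1 + Real.exp (-(2 * (n : ℝ) + 3) / 3)) ^ n
      ≤ Real.exp (Real.exp (-(2 * (n : ℝ) + 3) / 3)) ^ n := by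
        gcongr
        rw [add_comm]
        exact Real.add_one_le_exp _
    _ = Real.exp (n * Real.exp (-(2 * (n : ℝ) + 3) / 3)) := (Real.exp_nat_mul _ _).symm
    _ ≤ _ := Real.exp_le_exp.2 hn

theorem sum_choose_succ_mul_pow (n : ℕ) (q : ℝ) :
    ∑ i ∈ Finset.range n, (n.choose (i + 1) : ℝ) * q ^ (i + 1) = (1 + q) ^ n - 1 := by
  rw [add_comm 1 q, add_pow, Finset.sum_range_succ']
  simp [mul_comm]

/-- The terms of order at least three are dominated by the quadratic one. -/
theorem sum_higher_order_le (n : ℕ) {τ s : ℝ} (hτ0 : 0 < τ)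
    (hs : 3 / 2 ≤ s) (hτ : τ * (1 + s) ≤ Real.exp (-((n : ℝ) + 2))) :
    ∑ j ∈ Finset.Icc 3 (n + 2),
        τ ^ j * ((n + 2).choose j : ℝ) * (2 * Real.exp (((j : ℝ) - 1) * j / (2 * s))) ≤
      τ ^ 2 * ((n + 2).choose 2 : ℝ) * (4 / s) := by
  have hs0 : 0 < s := by linarith
  set q := Real.exp (-(2 * (n : ℝ) + 3) / 3) with hq
  have hIcc : Finset.Icc 3 (n + 2) = Finset.Ico 3 (n + 3) := by
    ext
    simp only [Finset.mem_Icc, Finset.mem_Ico]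
    omega
  rw [hIcc, Finset.sum_Ico_eq_sum_range, Nat.add_sub_cancel]
  have hterm : ∀ i ∈ Finset.range n,
      τ ^ (3 + i) * ((n + 2).choose (3 + i) : ℝ) *
          (2 * Real.exp ((((3 + i : ℕ) : ℝ) - 1) * ((3 + i : ℕ) : ℝ) / (2 * s))) ≤
        τ ^ 2 * ((n + 2).choose 2 : ℝ) * (2 * (Real.exp (2 / 3) / s)) *
          ((n.choose (i + 1) : ℝ) * q ^ (i + 1)) := by
    intro i hi
    have hin : i + 1 ≤ n := Finset.mem_range.1 hi
    have h1 := pow_mul_exp_le (k := i + 1) (by omega) hin hτ0 hs hτ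
    have h2 : ((n + 2).choose (i + 1 + 2) : ℝ) ≤ (n + 2).choose 2 * n.choose (i + 1) := by
      exact_mod_cast choose_add_two_le n (i + 1)
    rw [← hq] at h1
    rw [show 3 + i = i + 1 + 2 by omega,
      show (((i + 1 + 2 : ℕ) : ℝ) - 1) * ((i + 1 + 2 : ℕ) : ℝ) =
        (((i + 1 : ℕ) : ℝ) + 1) * (((i + 1 : ℕ) : ℝ) + 2) by push_cast; ring]
    calc _ = 2 * τ ^ 2 * (((n + 2).choose (i + 1 + 2) : ℝ) * (τ ^ (i + 1) *
            Real.exp ((((i + 1 : ℕ) : ℝ) + 1) * (((i + 1 : ℕ) : ℝ) + 2) / (2 * s)))) := by ring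
      _ ≤ 2 * τ ^ 2 * (((n + 2).choose 2 * n.choose (i + 1)) *
            (Real.exp (2 / 3) / s * q ^ (i + 1))) := by gcongr
      _ = _ := by ring
  refine (Finset.sum_le_sum hterm).trans ?_
  rw [← Finset.mul_sum, sum_choose_succ_mul_pow, mul_assoc]
  gcongr
  rw [← mul_div_assoc, div_mul_eq_mul_div]
  gcongr
  have h1 := one_add_exp_pow_le n
  rw [← hq] at h1
  have h2 := exp_two_thirds_le
  nlinarith [Real.exp_pos (2 / 3)]

/-- Full analytic content of the RDP guarantee of the subsampled Gaussian
mechanism: for a natural number `α ≥ 2`, `τ ∈ (0,1)` and `σ² ≥ 3/2`, if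
`α ≤ log(1/(τ(1+σ²)))` then
`(1/(α−1)) log(1 + τ² C(α,2) min{4(e^{2/(2σ²)} − 1), 2 e^{2/(2σ²)}}
     + ∑_{j=3}^{α} τ^j C(α,j) 2 e^{(j−1)j/(2σ²)}) ≤ 5 α τ²/σ²`. -/
theorem statement16 (α : ℕ) (hα : 2 ≤ α) (τ σ : ℝ) (hτ0 : 0 < τ) (hτ1 : τ < 1)
    (hσ : 3 / 2 ≤ σ ^ 2)
    (h : (α : ℝ) ≤ Real.log (1 / (τ * (1 + σ ^ 2)))) :
    (1 / ((α : ℝ) - 1)) *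
        Real.log (1 + τ ^ 2 * (α.choose 2 : ℝ) *
            min (4 * (Real.exp (2 / (2 * σ ^ 2)) - 1)) (2 * Real.exp (2 / (2 * σ ^ 2)))
          + ∑ j ∈ Finset.Icc 3 α,
              τ ^ j * (α.choose j : ℝ) * (2 * Real.exp (((j : ℝ) - 1) * j / (2 * σ ^ 2))))
      ≤ 5 * α * τ ^ 2 / σ ^ 2 := by
  obtain ⟨n, rfl⟩ : ∃ n, α = n + 2 := ⟨α - 2, by omega⟩
  have hs0 : 0 < σ ^ 2 := by linarith
  generalize σ ^ 2 = s at *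
  have hτs : 0 < τ * (1 + s) := by positivity
  have hτ : τ * (1 + s) ≤ Real.exp (-((n : ℝ) + 2)) := by
    rw [one_div, Real.log_inv] at h
    push_cast at h
    rw [← Real.log_le_iff_le_exp hτs]
    linarith
  have hsum := sum_higher_order_le n hτ0 hσ hτ
  have hmin : min (4 * (Real.exp (2 / (2 * s)) - 1)) (2 * Real.exp (2 / (2 * s))) ≤ 6 / s := by
    refine (min_le_left _ _).trans ?_
    have hx : 2 / (2 * s) ≤ 2 / 3 := by
      gcongr
      linarith
    have h1 := exp_sub_one_le_mul (by positivity) hx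
    have h2 : 2 / (2 * s) = 1 / s := mul_div_mul_left 1 s two_ne_zero ▸ by norm_num
    have h3 : 6 / s = 6 * (1 / s) := by ring
    have h4 : 0 < 1 / s := by positivity
    rw [h2] at h1 ⊢
    linarith
  have hmin0 : 0 ≤ min (4 * (Real.exp (2 / (2 * s)) - 1)) (2 * Real.exp (2 / (2 * s))) := by
    refine le_min ?_ (by positivity)
    have : 1 ≤ Real.exp (2 / (2 * s)) := Real.one_le_exp (by positivity)
    linarith
  generalize min (4 * (Real.exp (2 / (2 * s)) - 1)) (2 * Real.exp (2 / (2 * s))) = m at *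
  have hsum0 : 0 ≤ ∑ j ∈ Finset.Icc 3 (n + 2),
      τ ^ j * ((n + 2).choose j : ℝ) * (2 * Real.exp (((j : ℝ) - 1) * j / (2 * s))) :=
    Finset.sum_nonneg fun j _ => by positivity
  generalize ∑ j ∈ Finset.Icc 3 (n + 2),
      τ ^ j * ((n + 2).choose j : ℝ) * (2 * Real.exp (((j : ℝ) - 1) * j / (2 * s))) = S at *
  have hquad : τ ^ 2 * ((n + 2).choose 2 : ℝ) * m ≤
      τ ^ 2 * ((n + 2).choose 2 : ℝ) * (6 / s) := by gcongr
  have hquad0 : 0 ≤ τ ^ 2 * ((n + 2).choose 2 : ℝ) * m := by positivity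
  have hlog := Real.log_le_sub_one_of_pos
    (show 0 < 1 + τ ^ 2 * ((n + 2).choose 2 : ℝ) * m + S by linarith)
  have hn : (0 : ℝ) < ((n + 2 : ℕ) : ℝ) - 1 := by
    push_cast
    linarith [Nat.cast_nonneg (α := ℝ) n]
  rw [one_div_mul_eq_div, div_le_iff₀ hn]
  have hrhs : 5 * ((n + 2 : ℕ) : ℝ) * τ ^ 2 / s * (((n + 2 : ℕ) : ℝ) - 1) =
      τ ^ 2 * ((n + 2).choose 2 : ℝ) * (6 / s) + τ ^ 2 * ((n + 2).choose 2 : ℝ) * (4 / s) := by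
    rw [Nat.cast_choose_two]
    ring
  linarith
end
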